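/- Let A be the companion matrix of f(x) = (x-1)³(x²+1) and B the companion matrix of g(x) = (x+1)(x²+x+1)(x²−x+1), and set T = B·A⁻¹ in GL(5,ℚ). Then T² = I with T ≠ I, B has order 6 and no power of B equals −I, and the hypergeometric group Γ(f,g) = ⟨A,B⟩ is the free product of the subgroup generated by T and the subgroup generated by B: the canonical group homomorphism from the abstract free product (ℤ/2ℤ) ∗ (ℤ/6ℤ) to GL(5,ℚ) sending the generator of ℤ/2ℤ to T and the generator of ℤ/6ℤ to B is injective with image Γ(f,g). -/

import Mathlib

open Polynomial Matrix

/-- The companion matrix of a monic degree-5 rational polynomial `p`: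
the `5 × 5` matrix whose entries in position `(i+1, i)` equal `1` for
`i = 1, ..., 4`, whose last column is `(-p₀, -p₁, -p₂, -p₃, -p₄)ᵀ`
(where `pᵢ` is the coefficient of `xⁱ` in `p`), and whose remaining
entries are `0`. -/
def companionMatrix (p : ℚ[X]) : Matrix (Fin 5) (Fin 5) ℚ :=
  Matrix.of fun i j : Fin 5 =>
    if (j : ℕ) = 4 then -p.coeff i
    else if (i : ℕ) = (j : ℕ) + 1 then 1 else 0

theorem Monoid.Coprod.lift_injective_of_ping_pong.{u, v, w} {G H : Type u} {K : Type v}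
    {α : Type w} [Group G] [Group H] [Group K] [MulAction K α] (f : G →* K) (g : H →* K) (hcard : 3 ≤ Cardinal.mk H)
    (X Y : Set α) (hX : X.Nonempty) (hY : Y.Nonempty) (hXY : Disjoint X Y)
    (hf : ∀ a : G, a ≠ 1 → ∀ x ∈ X, f a • x ∈ Y) (hg : ∀ b : H, b ≠ 1 → ∀ y ∈ Y, g b • y ∈ X) :
    Function.Injective (Monoid.Coprod.lift f g) := by
  let F : Bool → Type u := fun i => cond i H G
  let _ : ∀ i, Group (F i) := Bool.rec ‹Group G› ‹Group H›
  let k : ∀ i, F i →* K := Bool.rec f g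
  let ψ : Monoid.Coprod G H →* Monoid.CoprodI F :=
    Monoid.Coprod.lift (Monoid.CoprodI.of (M := F) (i := false))
      (Monoid.CoprodI.of (M := F) (i := true))
  let incl : ∀ i, F i →* Monoid.Coprod G H := Bool.rec Monoid.Coprod.inl Monoid.Coprod.inr
  have hψ : Function.Injective ψ := by
    have h : (Monoid.CoprodI.lift incl).comp ψ = MonoidHom.id _ := by
      apply Monoid.Coprod.hom_ext
      · ext a
        exact Monoid.CoprodI.lift_of (fi := incl) (i := false) a
      · ext b
        exact Monoid.CoprodI.lift_of (fi := incl) (i := true) b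
    exact Function.LeftInverse.injective fun a => DFunLike.congr_fun h a
  have hlift : Monoid.Coprod.lift f g = (Monoid.CoprodI.lift k).comp ψ := by
    apply Monoid.Coprod.hom_ext
    · ext a
      exact (Monoid.CoprodI.lift_of (fi := k) (i := false) a).symm
    · ext b
      exact (Monoid.CoprodI.lift_of (fi := k) (i := true) b).symm
  rw [hlift, MonoidHom.coe_comp]
  refine Function.Injective.comp ?_ hψ
  refine Monoid.CoprodI.lift_injective_of_ping_pong k (.inr ⟨true, hcard⟩)
    (fun i => cond i X Y) (by rintro (_ | _) <;> assumption) ?_ ?_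
  · rintro (_ | _) (_ | _) h
    exacts [absurd rfl h, hXY.symm, hXY, absurd rfl h]
  · rintro (_ | _) (_ | _) h a ha
    · exact absurd rfl h
    · rintro _ ⟨x, hx, rfl⟩
      exact hf a ha x hx
    · rintro _ ⟨y, hy, rfl⟩
      exact hg a ha y hy
    · exact absurd rfl h

/-- The homomorphism from the cyclic group of order `n` sending the generator to `g`. -/
def zmodPowersHom {G : Type*} [Group G] (n : ℕ) (g : G) (hg : g ^ n = 1) :
    Multiplicative (ZMod n) →* G :=
  AddMonoidHom.toMultiplicativeLeft
    (ZMod.lift n ⟨zmultiplesHom (Additive G) (Additive.ofMul g), by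
      simpa using congrArg Additive.ofMul hg⟩)

theorem zmodPowersHom_ofAdd_intCast {G : Type*} [Group G] (n : ℕ) (g : G) (hg : g ^ n = 1)
    (k : ℤ) : zmodPowersHom n g hg (Multiplicative.ofAdd (k : ZMod n)) = g ^ k := by
  simp [zmodPowersHom]

theorem zmodPowersHom_ofAdd_one {G : Type*} [Group G] (n : ℕ) (g : G) (hg : g ^ n = 1) :
    zmodPowersHom n g hg (Multiplicative.ofAdd (1 : ZMod n)) = g := by
  simpa using zmodPowersHom_ofAdd_intCast n g hg 1

theorem zmodPowersHom_apply {G : Type*} [Group G] (n : ℕ) [NeZero n] (g : G) (hg : g ^ n = 1)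
    (a : Multiplicative (ZMod n)) : zmodPowersHom n g hg a = g ^ a.toAdd.val := by
  have h := zmodPowersHom_ofAdd_intCast n g hg a.toAdd.val
  rwa [Int.cast_natCast, ZMod.natCast_zmod_val, ofAdd_toAdd, zpow_natCast] at h

theorem range_zmodPowersHom {G : Type*} [Group G] (n : ℕ) (g : G) (hg : g ^ n = 1) :
    (zmodPowersHom n g hg).range = Subgroup.zpowers g := by
  ext x
  rw [MonoidHom.mem_range, Subgroup.mem_zpowers_iff]
  constructor
  · rintro ⟨a, rfl⟩
    obtain ⟨k, hk⟩ := ZMod.intCast_surjective a.toAdd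
    exact ⟨k, by rw [← zmodPowersHom_ofAdd_intCast n g hg, hk, ofAdd_toAdd]⟩
  · rintro ⟨k, rfl⟩
    exact ⟨_, zmodPowersHom_ofAdd_intCast n g hg k⟩

theorem companionMatrix_sub_one_cube :
    companionMatrix ((X - 1) ^ 3 * (X ^ 2 + 1)) =
      !![0, 0, 0, 0, 1; 1, 0, 0, 0, -3; 0, 1, 0, 0, 4; 0, 0, 1, 0, -4; 0, 0, 0, 1, 3] := by
  have h : ((X - 1) ^ 3 * (X ^ 2 + 1) : ℚ[X]) =
      X ^ 5 - C 3 * X ^ 4 + C 4 * X ^ 3 - C 4 * X ^ 2 + C 3 * X - 1 := by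
    simp only [map_ofNat]
    ring
  rw [h]
  ext i j
  fin_cases i <;> fin_cases j <;> simp [companionMatrix, coeff_X, coeff_one, coeff_X_pow]

theorem companionMatrix_geom_sum :
    companionMatrix ((X + 1) * (X ^ 2 + X + 1) * (X ^ 2 - X + 1)) =
      !![0, 0, 0, 0, -1; 1, 0, 0, 0, -1; 0, 1, 0, 0, -1; 0, 0, 1, 0, -1; 0, 0, 0, 1, -1] := by
  have h : ((X + 1) * (X ^ 2 + X + 1) * (X ^ 2 - X + 1) : ℚ[X]) =
      X ^ 5 + X ^ 4 + X ^ 3 + X ^ 2 + X + 1 := by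
    ring
  rw [h]
  ext i j
  fin_cases i <;> fin_cases j <;> simp [companionMatrix, coeff_X, coeff_one, coeff_X_pow]

namespace HypergeometricPingPong

/-- The action of the companion matrix of `1 + X + X² + X³ + X⁴ + X⁵`. -/
def shift (x : Fin 5 → ℚ) : Fin 5 → ℚ :=
  ![-x 4, x 0 - x 4, x 1 - x 4, x 2 - x 4, x 3 - x 4]

/-- The action of the reflection `T`. -/
def reflection (x : Fin 5 → ℚ) : Fin 5 → ℚ :=
  ![-x 0, x 1 + 2 * x 0, x 2 - 5 * x 0, x 3 + 3 * x 0, x 4 - 4 * x 0]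

/-- A functional negated by `shift`, whose sign tells the two nappes of the cone
`0 < quadForm x` apart. -/
def timeForm (x : Fin 5 → ℚ) : ℚ := x 0 - x 1 + x 2 - x 3 + x 4

/-- A functional fixed by `reflection`; its kernel bounds the half-spaces of the ping-pong. -/
def wallForm (x : Fin 5 → ℚ) : ℚ := 5 * x 0 + 3 * x 1 + x 2 - x 3 - 3 * x 4

/-- The invariant quadratic form, of signature `(1, 4)`. -/
def quadForm (x : Fin 5 → ℚ) : ℚ :=
  3 * timeForm x ^ 2
    - 48 * ((x 0 - x 3) ^ 2 + (x 1 - x 4) ^ 2 + x 2 ^ 2 + (x 0 - x 3) * (x 1 - x 4)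
      + (x 1 - x 4) * x 2 - (x 0 - x 3) * x 2)
    - 16 * ((x 0 + x 3) ^ 2 + (x 1 + x 4) ^ 2 + x 2 ^ 2 - (x 0 + x 3) * (x 1 + x 4)
      - (x 1 + x 4) * x 2 - (x 0 + x 3) * x 2)

theorem quadForm_shift (x : Fin 5 → ℚ) : quadForm (shift x) = quadForm x := by
  simp [quadForm, timeForm, shift]
  ring

theorem shift_iterate_six (x : Fin 5 → ℚ) : shift^[6] x = x := by
  simp only [Function.iterate_succ, Function.iterate_zero, Function.comp, id, shift,
    Matrix.cons_val]
  ext i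
  fin_cases i <;> simp <;> ring

theorem quadForm_reflection (x : Fin 5 → ℚ) : quadForm (reflection x) = quadForm x := by
  simp [quadForm, timeForm, reflection]
  ring

theorem reflection_reflection (x : Fin 5 → ℚ) : reflection (reflection x) = x := by
  ext i
  fin_cases i <;> simp [reflection]

theorem wallForm_reflection (x : Fin 5 → ℚ) : wallForm (reflection x) = wallForm x := by
  simp [wallForm, reflection]
  ring

theorem timeForm_mul_timeForm_reflection_neg {x : Fin 5 → ℚ} (hx : 0 < quadForm x) :
    timeForm x * timeForm (reflection x) < 0 := by
  simp only [quadForm, timeForm, reflection, Matrix.cons_val] at hx ⊢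
  linarith [sq_nonneg (x 0 + 73 / 484 * x 1 - 1 / 2 * x 2 - 217 / 242 * x 3 - 1 / 2 * x 4),
    sq_nonneg (x 1 + 242 / 589 * x 2 - 306 / 589 * x 3 - 242 / 589 * x 4),
    sq_nonneg (x 2 + 17 / 52 * x 3 - x 4), sq_nonneg (x 3),
    sq_nonneg (x 0 * 16 - (x 0 - x 1 + x 2 - x 3 + x 4))]

/-- The part of the cone `0 < quadForm x` on the side of the wall that `shift` leaves. -/
def innerRegion : Set (Fin 5 → ℚ) := {x | 0 < quadForm x ∧ wallForm x * timeForm x < 0}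

/-- The part of the cone `0 < quadForm x` on the other side of the wall. -/
def outerRegion : Set (Fin 5 → ℚ) := {x | 0 < quadForm x ∧ 0 < wallForm x * timeForm x}

theorem disjoint_outerRegion_innerRegion : Disjoint outerRegion innerRegion :=
  Set.disjoint_left.2 fun _ hx hy => hx.2.not_gt hy.2

theorem reflection_mem_innerRegion {x : Fin 5 → ℚ} (hx : x ∈ outerRegion) :
    reflection x ∈ innerRegion := by
  refine ⟨by rw [quadForm_reflection]; exact hx.1, ?_⟩
  have h := timeForm_mul_timeForm_reflection_neg hx.1
  rw [wallForm_reflection]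
  nlinarith [hx.2, mul_pos hx.2 (neg_pos.2 h), sq_nonneg (timeForm x)]

theorem shift_iterate_mem_outerRegion {x : Fin 5 → ℚ} (hx : x ∈ innerRegion) {k : ℕ}
    (hk₀ : k ≠ 0) (hk : k < 6) : shift^[k] x ∈ outerRegion := by
  obtain ⟨hq, hw⟩ := hx
  have hquad : quadForm (shift^[k] x) = quadForm x :=
    congrFun (Function.Semiconj.iterate_right (f := quadForm) (gb := id)
      quadForm_shift k |>.comp_eq.trans (by simp)) x
  refine ⟨hquad ▸ hq, ?_⟩
  interval_cases k
  · exact absurd rfl hk₀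
  all_goals
    simp only [Function.iterate_succ, Function.iterate_zero, Function.comp, id, quadForm, wallForm,
      timeForm, shift, Matrix.cons_val] at hq hw ⊢
  · linarith [sq_nonneg (x 0 + x 1 / 4 - x 2 / 2 - x 3 / 2 - x 4 / 2),
      sq_nonneg (x 1 + x 2 / 2 - 3 / 4 * x 3 - x 4 / 2), sq_nonneg (x 2 + x 3 / 2 - x 4),
      sq_nonneg (x 0 + x 1 + x 2 + x 3 + x 4)]
  · linarith [sq_nonneg (x 0 + x 1 / 13 - 5 / 13 * x 2 - 5 / 13 * x 3 - 8 / 13 * x 4),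
      sq_nonneg (x 1 + 4 / 7 * x 2 - 5 / 14 * x 3 - 4 / 7 * x 4),
      sq_nonneg (x 2 + x 3 / 4 - x 4), sq_nonneg (x 3),
      sq_nonneg (3 * x 0 + x 1 - x 2 - 3 * x 3 + x 4)]
  · linarith [sq_nonneg (x 0 - 2 / 13 * x 1 - 11 / 13 * x 2 - 5 / 13 * x 3 - 2 / 13 * x 4),
      sq_nonneg (x 1 - x 2 - 3 / 4 * x 3 + x 4), sq_nonneg (x 3),
      sq_nonneg (x 0 + x 1 + x 2 - x 3 - x 4)]
  · linarith [sq_nonneg (x 0 + x 1 / 4 - x 2 / 2 - x 3 / 2 - x 4 / 2),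
      sq_nonneg (x 1 + 2 / 5 * x 2 - 2 / 5 * x 3 - 2 / 5 * x 4),
      sq_nonneg (x 2 - x 3 / 11 - x 4), sq_nonneg (x 3),
      sq_nonneg (x 0 - x 1 + 3 * x 2 + x 3 - x 4)]
  · linarith [sq_nonneg (x 0 + x 1 - x 2 / 2 - 2 * x 3 - x 4 / 2),
      sq_nonneg (x 1 + x 2 / 2 - x 4 / 2), sq_nonneg (x 2 - x 4),
      sq_nonneg (5 * x 0 - x 1 - x 2 - x 3 - x 4)]

theorem outerRegion_nonempty : outerRegion.Nonempty :=
  ⟨![2, 0, 2, 0, 2], by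
    simp only [outerRegion, Set.mem_ofPred_eq, quadForm, wallForm, timeForm, Matrix.cons_val]
    norm_num⟩

theorem innerRegion_nonempty : innerRegion.Nonempty :=
  outerRegion_nonempty.imp' reflection fun _ => reflection_mem_innerRegion

theorem neg_mem_innerRegion {x : Fin 5 → ℚ} (hx : x ∈ innerRegion) : -x ∈ innerRegion := by
  simp only [innerRegion, Set.mem_ofPred_eq, quadForm, wallForm, timeForm, Pi.neg_apply] at hx ⊢
  exact ⟨by linarith [hx.1], by linarith [hx.2]⟩

theorem mulVec_eq_shift (x : Fin 5 → ℚ) :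
    !![0, 0, 0, 0, -1; 1, 0, 0, 0, -1; 0, 1, 0, 0, -1; 0, 0, 1, 0, -1; 0, 0, 0, 1, -1] *ᵥ x =
      shift x := by
  ext i
  fin_cases i <;> simp [shift, Matrix.mulVec, dotProduct, Fin.sum_univ_five] <;> ring

theorem mulVec_eq_reflection (x : Fin 5 → ℚ) :
    !![-1, 0, 0, 0, 0; 2, 1, 0, 0, 0; -5, 0, 1, 0, 0; 3, 0, 0, 1, 0; -4, 0, 0, 0, 1] *ᵥ x =
      reflection x := by
  ext i
  fin_cases i <;> simp [reflection, Matrix.mulVec, dotProduct, Fin.sum_univ_five] <;> ring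

theorem pow_mulVec {n R : Type*} [Fintype n] [DecidableEq n] [Semiring R] (M : Matrix n n R)
    (k : ℕ) (x : n → R) : (M ^ k) *ᵥ x = (M *ᵥ ·)^[k] x := by
  induction k generalizing x with
  | zero => simp
  | succ k ih => rw [pow_succ, ← Matrix.mulVec_mulVec, ih, Function.iterate_succ_apply]

end HypergeometricPingPong

open HypergeometricPingPong

/-- `Γ(f,g) = ⟨T⟩ ∗ ⟨B⟩` for `f = ((X - 1) ^ 3 * (X ^ 2 + 1))`, `g = ((X + 1) * (X ^ 2 + X + 1) * (X ^ 2 - X + 1))`. -/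
theorem hypergeometric_free_product_case15 (A B T : GL (Fin 5) ℚ)
    (hA : (↑A : Matrix (Fin 5) (Fin 5) ℚ) = companionMatrix ((X - 1) ^ 3 * (X ^ 2 + 1)))
    (hB : (↑B : Matrix (Fin 5) (Fin 5) ℚ) = companionMatrix ((X + 1) * (X ^ 2 + X + 1) * (X ^ 2 - X + 1)))
    (hT : T = B * A⁻¹) :
    T ^ 2 = 1 ∧ T ≠ 1 ∧ orderOf B = 6 ∧ (∀ i : ℤ, B ^ i ≠ -1) ∧
    ∃ φ : Monoid.Coprod (Multiplicative (ZMod 2)) (Multiplicative (ZMod 6)) →* GL (Fin 5) ℚ,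
      φ (Monoid.Coprod.inl (Multiplicative.ofAdd (1 : ZMod 2))) = T ∧
      φ (Monoid.Coprod.inr (Multiplicative.ofAdd (1 : ZMod 6))) = B ∧
      Function.Injective φ ∧
      φ.range = Subgroup.closure {A, B} := by
  rw [companionMatrix_sub_one_cube] at hA
  rw [companionMatrix_geom_sum] at hB
  let M : Matrix (Fin 5) (Fin 5) ℚ :=
    !![-1, 0, 0, 0, 0; 2, 1, 0, 0, 0; -5, 0, 1, 0, 0; 3, 0, 0, 1, 0; -4, 0, 0, 0, 1]
  have hM : M * M = 1 := by
    refine Matrix.ext_of_mulVec_single fun i => ?_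
    rw [← Matrix.mulVec_mulVec, mulVec_eq_reflection, mulVec_eq_reflection, reflection_reflection,
      Matrix.one_mulVec]
  have hMA : !![0, 0, 0, 0, -1; 1, 0, 0, 0, -1; 0, 1, 0, 0, -1; 0, 0, 1, 0, -1; 0, 0, 0, 1, -1] =
      M * !![0, 0, 0, 0, 1; 1, 0, 0, 0, -3; 0, 1, 0, 0, 4; 0, 0, 1, 0, -4; 0, 0, 0, 1, 3] := by
    norm_num [M, Matrix.cons_mul, Matrix.vecMul_cons]
  have hTM : T = ⟨M, M, hM, hM⟩ := by
    rw [hT, mul_inv_eq_iff_eq_mul]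
    ext1
    rw [Units.val_mul, hA, hB]
    exact hMA
  have hT2 : T ^ 2 = 1 := by
    rw [hTM, pow_two]
    exact Units.ext hM
  have hB6 : B ^ 6 = 1 := by
    ext1
    refine Matrix.ext_of_mulVec_single fun i => ?_
    rw [Units.val_pow_eq_pow_val, pow_mulVec, hB, funext mulVec_eq_shift, shift_iterate_six,
      Units.val_one, Matrix.one_mulVec]
  have hTx {x : Fin 5 → ℚ} (hx : x ∈ outerRegion) : T.val *ᵥ x ∈ innerRegion := by
    rw [hTM, mulVec_eq_reflection]
    exact reflection_mem_innerRegion hx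
  have hBx {x : Fin 5 → ℚ} (hx : x ∈ innerRegion) {k : ℕ} (hk₀ : k ≠ 0) (hk : k < 6) :
      (B ^ k).val *ᵥ x ∈ outerRegion := by
    rw [Units.val_pow_eq_pow_val, pow_mulVec, hB, funext mulVec_eq_shift]
    exact shift_iterate_mem_outerRegion hx hk₀ hk
  have hdisj {x : Fin 5 → ℚ} (hx : x ∈ outerRegion) : x ∉ innerRegion :=
    Set.disjoint_left.1 disjoint_outerRegion_innerRegion hx
  obtain ⟨x, hx⟩ := innerRegion_nonempty
  have hBorder : orderOf B = 6 := by
    refine (orderOf_eq_iff (by norm_num)).2 ⟨hB6, fun k hk hk₀ h => ?_⟩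
    have := hBx hx hk₀.ne' hk
    rw [h, Units.val_one, Matrix.one_mulVec] at this
    exact hdisj this hx
  refine ⟨hT2, ?_, hBorder, ?_,
    Monoid.Coprod.lift (zmodPowersHom 2 T hT2) (zmodPowersHom 6 B hB6), ?_, ?_, ?_, ?_⟩
  · rintro rfl
    obtain ⟨y, hy⟩ := outerRegion_nonempty
    have := hTx hy
    rw [Units.val_one, Matrix.one_mulVec] at this
    exact hdisj hy this
  · intro i hi
    rw [← zpow_mod_orderOf, hBorder] at hi
    obtain ⟨k, hk⟩ := Int.eq_ofNat_of_zero_le (Int.emod_nonneg i (by norm_num : ((6 : ℕ) : ℤ) ≠ 0))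
    have hk6 : k < 6 := by omega
    rw [hk, zpow_natCast] at hi
    have hneg : (B ^ k).val *ᵥ x = -x := by
      rw [hi, Units.val_neg, Units.val_one, Matrix.neg_mulVec, Matrix.one_mulVec]
    rcases eq_or_ne k 0 with rfl | hk₀
    · rw [pow_zero, Units.val_one, Matrix.one_mulVec, self_eq_neg] at hneg
      subst hneg
      simp [innerRegion, quadForm, timeForm] at hx
    · exact hdisj (hBx hx hk₀ hk6) (hneg ▸ neg_mem_innerRegion hx)
  · rw [Monoid.Coprod.lift_apply_inl, zmodPowersHom_ofAdd_one]
  · rw [Monoid.Coprod.lift_apply_inr, zmodPowersHom_ofAdd_one]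
  · let _ : MulAction (GL (Fin 5) ℚ) (Fin 5 → ℚ) :=
      MulAction.compHom _ (Matrix.GeneralLinearGroup.toLin (n := Fin 5) (R := ℚ)).toMonoidHom
    refine Monoid.Coprod.lift_injective_of_ping_pong _ _ ?_ outerRegion innerRegion
      outerRegion_nonempty innerRegion_nonempty disjoint_outerRegion_innerRegion ?_ ?_
    · rw [Cardinal.mk_fintype, Fintype.card_multiplicative, ZMod.card]
      norm_num
    · intro a ha y hy
      have hval : a.toAdd.val = 1 := by
        have := ZMod.val_lt a.toAdd
        have := (ZMod.val_ne_zero a.toAdd).2 (toAdd_eq_zero.not.2 ha)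
        omega
      rw [zmodPowersHom_apply, hval, pow_one]
      exact hTx hy
    · intro b hb y hy
      rw [zmodPowersHom_apply]
      exact hBx hy ((ZMod.val_ne_zero b.toAdd).2 (toAdd_eq_zero.not.2 hb)) (ZMod.val_lt _)
  · rw [Monoid.Coprod.range_lift, range_zmodPowersHom, range_zmodPowersHom]
    apply le_antisymm
    · have hAmem : A ∈ Subgroup.closure {A, B} := Subgroup.subset_closure (by simp)
      have hBmem : B ∈ Subgroup.closure {A, B} := Subgroup.subset_closure (by simp)
      rw [sup_le_iff, Subgroup.zpowers_le, Subgroup.zpowers_le, hT]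
      exact ⟨mul_mem hBmem (inv_mem hAmem), hBmem⟩
    · have hTmem : T ∈ Subgroup.zpowers T ⊔ Subgroup.zpowers B :=
        Subgroup.mem_sup_left (Subgroup.mem_zpowers T)
      have hBmem : B ∈ Subgroup.zpowers T ⊔ Subgroup.zpowers B :=
        Subgroup.mem_sup_right (Subgroup.mem_zpowers B)
      have hA' : A = T⁻¹ * B := by rw [hT]; group
      rw [Subgroup.closure_le, Set.insert_subset_iff, Set.singleton_subset_iff]
      exact ⟨hA' ▸ mul_mem (inv_mem hTmem) hBmem, hBmem⟩
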